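/- arXiv:1308.3730 — 2 statements merged into one kernel-verified Lean document; each statement's English description precedes it below -/
import Mathlib

section
/- Let δ be a J×J matrix of free polynomials, let Λ ∈ G_δ ∩ M_n^d and let W ∈ M_n(ℂ). Then there exists a function φ in the closed unit ball of H^∞(G_δ) with φ(Λ) = W if and only if there exists a free polynomial p₀ ∈ P^d such that p₀(Λ) = W and sup{‖p₀(x)‖ : x ∈ V_Λ ∩ G_δ} ≤ 1. -/
/- ## Basic framework for free (nc) function theory -/

noncomputable section

/-- A point of `M_n^d`: a `d`-tuple of `n × n` complex matrices. -/
abbrev MatTuple (d n : ℕ) : Type := Fin d → Matrix (Fin n) (Fin n) ℂ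

/-- Evaluation of a free polynomial `p ∈ P^d` at a `d`-tuple of `n × n` matrices:
the unital algebra homomorphism sending the `r`-th variable to `x r`. -/
noncomputable def evalPoly {d n : ℕ} (p : FreeAlgebra ℂ (Fin d)) (x : MatTuple d n) :
    Matrix (Fin n) (Fin n) ℂ :=
  FreeAlgebra.lift ℂ x p

/-- The operator norm (`ℓ² → ℓ²`) of a square complex matrix. -/
noncomputable def opNorm {ι : Type*} [Fintype ι] [DecidableEq ι] (A : Matrix ι ι ℂ) : ℝ :=
  ‖Matrix.toEuclideanCLM (𝕜 := ℂ) A‖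

/-- Evaluation of a `J × J` matrix `δ` of free polynomials at `x ∈ M_n^d`:
the `Jn × Jn` matrix whose `(i,j)` block is `δ i j` evaluated at `x`. -/
noncomputable def evalMat {d n J : ℕ} (δ : Matrix (Fin J) (Fin J) (FreeAlgebra ℂ (Fin d)))
    (x : MatTuple d n) : Matrix (Fin J × Fin n) (Fin J × Fin n) ℂ :=
  fun a b => evalPoly (δ a.1 b.1) x a.2 b.2

/-- The basic free open set `G_δ = {x : ‖δ(x)‖ < 1}`, at matrix size `n`. -/
noncomputable def Gdel {d J : ℕ} (δ : Matrix (Fin J) (Fin J) (FreeAlgebra ℂ (Fin d))) (n : ℕ) :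
    Set (MatTuple d n) :=
  {x | opNorm (evalMat δ x) < 1}

/-- Direct sum of two square complex matrices. -/
def mdsum {m n : ℕ} (A : Matrix (Fin m) (Fin m) ℂ) (B : Matrix (Fin n) (Fin n) ℂ) :
    Matrix (Fin (m + n)) (Fin (m + n)) ℂ :=
  Matrix.reindex finSumFinEquiv finSumFinEquiv (Matrix.fromBlocks A 0 0 B)

/-- Direct sum of two tuples of matrices (coordinatewise direct sum). -/
def tdsum {d m n : ℕ} (x : MatTuple d m) (y : MatTuple d n) : MatTuple d (m + n) :=
  fun r => mdsum (x r) (y r)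

/-- `φ` is an nc-function on the graded domain `D`: it preserves direct sums
and similarities. -/
structure IsNCFn {d : ℕ} (D : ∀ n, Set (MatTuple d n))
    (φ : ∀ n, MatTuple d n → Matrix (Fin n) (Fin n) ℂ) : Prop where
  map_dsum : ∀ {m n : ℕ} (x : MatTuple d m) (y : MatTuple d n),
      x ∈ D m → y ∈ D n → tdsum x y ∈ D (m + n) →
      φ (m + n) (tdsum x y) = mdsum (φ m x) (φ n y)
  map_sim : ∀ {n : ℕ} (x : MatTuple d n) (s : Matrix (Fin n) (Fin n) ℂ),
      IsUnit s → x ∈ D n → (fun r => s⁻¹ * x r * s) ∈ D n →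
      φ n (fun r => s⁻¹ * x r * s) = s⁻¹ * φ n x * s

/-- `φ` is bounded by `C` on the graded domain `D`. -/
def BddBy {d : ℕ} (D : ∀ n, Set (MatTuple d n))
    (φ : ∀ n, MatTuple d n → Matrix (Fin n) (Fin n) ℂ) (C : ℝ) : Prop :=
  ∀ n, ∀ x ∈ D n, opNorm (φ n x) ≤ C

/-- `D` is open in the free topology: every point has a basic free open
neighbourhood contained in `D`. -/
def IsFreeOpen {d : ℕ} (D : ∀ n, Set (MatTuple d n)) : Prop :=
  ∀ n, ∀ x ∈ D n, ∃ (J : ℕ) (δ : Matrix (Fin J) (Fin J) (FreeAlgebra ℂ (Fin d))),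
    x ∈ Gdel δ n ∧ ∀ m, Gdel δ m ⊆ D m

/-- `φ` is a free holomorphic function on the free open set `U`: every point of `U`
lies in a basic free open subset of `U` on which `φ` is a bounded nc-function. -/
def IsFreeHolo {d : ℕ} (U : ∀ n, Set (MatTuple d n))
    (φ : ∀ n, MatTuple d n → Matrix (Fin n) (Fin n) ℂ) : Prop :=
  ∀ n, ∀ x ∈ U n, ∃ (J : ℕ) (δ : Matrix (Fin J) (Fin J) (FreeAlgebra ℂ (Fin d))),
    x ∈ Gdel δ n ∧ (∀ m, Gdel δ m ⊆ U m) ∧ IsNCFn (Gdel δ) φ ∧ ∃ C, BddBy (Gdel δ) φ C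

/-- `φ` belongs to the closed unit ball of `H^∞(U)`. -/
def MemBallHinf {d : ℕ} (U : ∀ n, Set (MatTuple d n))
    (φ : ∀ n, MatTuple d n → Matrix (Fin n) (Fin n) ℂ) : Prop :=
  IsFreeHolo U φ ∧ BddBy U φ 1

/-- The variety `V_Λ` determined by `Λ` (at matrix size `m`): common zero set of
the free polynomials annihilating `Λ`. -/
def VLam {d n : ℕ} (Λ : MatTuple d n) (m : ℕ) : Set (MatTuple d m) :=
  {x | ∀ p : FreeAlgebra ℂ (Fin d), evalPoly p Λ = 0 → evalPoly p x = 0}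

end

section PickInterpolation

open Matrix
open scoped Kronecker

/-- The squared `ℓ²` norm of a complex vector with finite index set. -/
noncomputable def nsq {ι : Type*} [Fintype ι] (v : ι → ℂ) : ℝ := ∑ i, ‖v i‖ ^ 2

section Norms

variable {ι κ : Type*} [Fintype ι] [Fintype κ]

lemma nsq_nonneg (v : ι → ℂ) : 0 ≤ nsq v := Finset.sum_nonneg fun _ _ => sq_nonneg _

lemma nsq_eq_norm_sq (v : ι → ℂ) : nsq v = ‖WithLp.toLp 2 v‖ ^ 2 := by
  rw [EuclideanSpace.norm_sq_eq]; rfl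

lemma nsq_eq_zero {v : ι → ℂ} : nsq v = 0 ↔ v = 0 := by
  rw [nsq_eq_norm_sq]; simp

lemma nsq_zero : nsq (0 : ι → ℂ) = 0 := nsq_eq_zero.2 rfl

lemma nsq_pos {v : ι → ℂ} (hv : v ≠ 0) : 0 < nsq v :=
  lt_of_le_of_ne (nsq_nonneg v) fun h => hv (nsq_eq_zero.1 h.symm)

lemma nsq_smul (c : ℂ) (v : ι → ℂ) : nsq (c • v) = ‖c‖ ^ 2 * nsq v := by
  simp [nsq, mul_pow, Finset.mul_sum]

lemma continuous_nsq : Continuous (nsq : (ι → ℂ) → ℝ) := by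
  unfold nsq; fun_prop

lemma nsq_prod (v : ι × κ → ℂ) : nsq v = ∑ i, nsq fun j => v (i, j) := by
  simp [nsq, Fintype.sum_prod_type]

lemma nsq_prod_right (v : ι × κ → ℂ) : nsq v = ∑ j, nsq fun i => v (i, j) := by
  simp [nsq, Fintype.sum_prod_type_right]

lemma nsq_sum_type (v : ι ⊕ κ → ℂ) :
    nsq v = nsq (fun i => v (Sum.inl i)) + nsq fun j => v (Sum.inr j) := by
  simp [nsq]

lemma isCompact_nsq_sphere : IsCompact {v : ι → ℂ | nsq v = 1} := by
  have h : {v : ι → ℂ | nsq v = 1} =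
      WithLp.ofLp '' Metric.sphere (0 : EuclideanSpace ℂ ι) 1 := by
    ext v
    simp only [Set.mem_ofPred_eq, Set.mem_image, mem_sphere_zero_iff_norm]
    constructor
    · intro hv
      refine ⟨WithLp.toLp 2 v, ?_, rfl⟩
      rw [nsq_eq_norm_sq] at hv
      nlinarith [norm_nonneg (WithLp.toLp 2 v : EuclideanSpace ℂ ι)]
    · rintro ⟨w, hw, rfl⟩
      rw [nsq_eq_norm_sq]; simp [hw]
  rw [h]
  exact (isCompact_sphere _ _).image (PiLp.continuous_ofLp 2 _)

lemma exists_smul_nsq_eq_one {v : ι → ℂ} (hv : v ≠ 0) :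
    ∃ c : ℝ, 0 < c ∧ nsq ((c : ℂ) • v) = 1 := by
  have h := nsq_pos hv
  refine ⟨(Real.sqrt (nsq v))⁻¹, by positivity, ?_⟩
  rw [nsq_smul, Complex.norm_real, Real.norm_eq_abs, sq_abs, inv_pow, Real.sq_sqrt h.le]
  exact inv_mul_cancel₀ h.ne'

variable [DecidableEq ι]

lemma opNorm_le_iff {A : Matrix ι ι ℂ} {c : ℝ} (hc : 0 ≤ c) :
    opNorm A ≤ c ↔ ∀ v, nsq (A *ᵥ v) ≤ c ^ 2 * nsq v := by
  unfold opNorm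
  rw [ContinuousLinearMap.opNorm_le_iff hc]
  constructor
  · intro h v
    have := h (WithLp.toLp 2 v)
    rw [Matrix.toEuclideanCLM_toLp] at this
    rw [nsq_eq_norm_sq, nsq_eq_norm_sq, ← mul_pow]
    gcongr
  · intro h v
    have := h (WithLp.ofLp v)
    rw [nsq_eq_norm_sq, nsq_eq_norm_sq, ← mul_pow] at this
    exact (sq_le_sq₀ (norm_nonneg _) (by positivity)).1 this

lemma opNorm_lt_one_iff {A : Matrix ι ι ℂ} :
    opNorm A < 1 ↔ ∃ c : ℝ, 0 ≤ c ∧ c < 1 ∧ ∀ v, nsq (A *ᵥ v) ≤ c * nsq v := by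
  constructor
  · intro h
    have h0 : 0 ≤ opNorm A := norm_nonneg _
    exact ⟨opNorm A ^ 2, sq_nonneg _, by nlinarith, (opNorm_le_iff h0).1 le_rfl⟩
  · rintro ⟨c, hc, hc1, h⟩
    refine lt_of_le_of_lt ((opNorm_le_iff (Real.sqrt_nonneg c)).2 ?_) ?_
    · simpa [Real.sq_sqrt hc] using h
    · rw [Real.sqrt_lt' one_pos]; simpa using hc1

lemma opNorm_lt_one_of_forall_lt {A : Matrix ι ι ℂ}
    (h : ∀ v, v ≠ 0 → nsq (A *ᵥ v) < nsq v) : opNorm A < 1 := by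
  rw [opNorm_lt_one_iff]
  rcases isEmpty_or_nonempty ι with hι | hι
  · exact ⟨0, le_rfl, one_pos, fun v => by simp [nsq]⟩
  have hne : {v : ι → ℂ | nsq v = 1}.Nonempty := by
    obtain ⟨c, -, hc⟩ := exists_smul_nsq_eq_one (one_ne_zero : (1 : ι → ℂ) ≠ 0)
    exact ⟨_, hc⟩
  have hcont : Continuous fun v : ι → ℂ => nsq (A *ᵥ v) :=
    continuous_nsq.comp (Continuous.matrix_mulVec continuous_const continuous_id)
  obtain ⟨v₀, hv₀, hmax⟩ := isCompact_nsq_sphere.exists_isMaxOn hne hcont.continuousOn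
  have hv₀' : nsq v₀ = 1 := hv₀
  refine ⟨nsq (A *ᵥ v₀), nsq_nonneg _, ?_, fun v => ?_⟩
  · rw [← hv₀']
    refine h _ fun h0 => ?_
    rw [h0, nsq_zero] at hv₀'
    exact zero_ne_one hv₀'
  · rcases eq_or_ne v 0 with rfl | hv
    · simp [nsq_zero]
    obtain ⟨c, hc, hcv⟩ := exists_smul_nsq_eq_one hv
    have h1 : nsq (A *ᵥ ((c : ℂ) • v)) ≤ nsq (A *ᵥ v₀) := hmax hcv
    rw [mulVec_smul, nsq_smul] at h1
    rw [nsq_smul] at hcv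
    have hp : 0 < ‖(c : ℂ)‖ ^ 2 := by simp; positivity
    refine le_of_mul_le_mul_left ?_ hp
    calc _ ≤ nsq (A *ᵥ v₀) := h1
      _ = nsq (A *ᵥ v₀) * (‖(c : ℂ)‖ ^ 2 * nsq v) := by rw [hcv, mul_one]
      _ = _ := by ring

end Norms

/-- In a finite-dimensional space the convex hull of a compact set is compact. -/
lemma IsCompact.convexHull_of_finiteDimensional {E : Type*} [AddCommGroup E] [Module ℝ E]
    [TopologicalSpace E] [ContinuousAdd E] [ContinuousSMul ℝ E] [FiniteDimensional ℝ E]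
    {s : Set E} (hs : IsCompact s) : IsCompact (convexHull ℝ s) := by
  rcases s.eq_empty_or_nonempty with rfl | ⟨z₀, hz₀⟩
  · simp
  set N := Module.finrank ℝ E + 1
  let Φ : (Fin N → ℝ) × (Fin N → E) → E := fun p => ∑ i, p.1 i • p.2 i
  have hΦ : Continuous Φ := by fun_prop
  have himage : convexHull ℝ s = Φ '' (stdSimplex ℝ (Fin N) ×ˢ Set.univ.pi fun _ => s) := by
    apply Set.Subset.antisymm
    · intro x hx
      obtain ⟨ι, _, z, w, hz, haff, hw, hw1, rfl⟩ := eq_pos_convex_span_of_mem_convexHull hx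
      classical
      have hcard : Fintype.card ι ≤ N := haff.card_le_finrank_succ.trans
        (Nat.succ_le_succ (Submodule.finrank_le _))
      obtain ⟨g, hg⟩ : ∃ g : ι → Fin N, Function.Injective g :=
        ⟨_, (Fin.castLE_injective hcard).comp (Fintype.equivFin ι).injective⟩
      have hext : ∀ i, i ∉ Set.range g → Function.extend g w 0 i = 0 := fun i hi => by
        rw [Function.extend_apply' _ _ _ hi]; rfl
      refine ⟨(Function.extend g w 0, Function.extend g z fun _ => z₀),
        ⟨⟨fun i => ?_, ?_⟩, fun i _ => ?_⟩, ?_⟩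
      · by_cases hi : i ∈ Set.range g
        · obtain ⟨j, rfl⟩ := hi
          simp only [hg.extend_apply]; exact (hw j).le
        · simp only [hext i hi, le_refl]
      · rw [← hw1]
        exact (Fintype.sum_of_injective g hg _ _ hext fun j => (hg.extend_apply _ _ j).symm).symm
      · by_cases hi : i ∈ Set.range g
        · obtain ⟨j, rfl⟩ := hi
          simp only [hg.extend_apply]; exact hz ⟨j, rfl⟩
        · simp only [Function.extend_apply' _ _ _ hi]; exact hz₀
      · refine (Fintype.sum_of_injective g hg _ _ (fun i hi => ?_) fun j => ?_).symm
        · simp only [hext i hi, zero_smul]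
        · simp only [hg.extend_apply]
    · rintro _ ⟨⟨w, z⟩, ⟨hw, hz⟩, rfl⟩
      exact (convex_convexHull ℝ s).sum_mem (fun i _ => hw.1 i) hw.2
        fun i _ => subset_convexHull ℝ s (hz i (Set.mem_univ i))
  rw [himage]
  exact ((isCompact_stdSimplex ℝ (Fin N)).prod (isCompact_univ_pi fun _ => hs)).image hΦ

section Separation

variable {κ : Type*}

/-- The rank-one Hermitian array `u uᴴ`. -/
def rankOne (u : κ → ℂ) : κ → κ → ℂ := fun i j => u i * star (u j)

lemma continuous_rankOne : Continuous (rankOne : (κ → ℂ) → κ → κ → ℂ) := by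
  unfold rankOne; fun_prop

lemma rankOne_smul (c : ℂ) (u : κ → ℂ) :
    rankOne (c • u) = (‖c‖ ^ 2 : ℝ) • rankOne u := by
  funext i j
  simp only [rankOne, Pi.smul_apply, smul_eq_mul, star_mul', Complex.real_smul]
  have h : c * star c = ((‖c‖ ^ 2 : ℝ) : ℂ) := by
    simpa using Complex.mul_conj' c
  rw [← h]; ring

variable [Fintype κ]

/-- The value at `f` of the Hermitian form on the dual space given by `X`. -/
noncomputable def hermForm (f : κ → ℂ) : (κ → κ → ℂ) →ₗ[ℝ] ℝ where
  toFun X := (∑ i, ∑ j, f i * X i j * star (f j)).re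
  map_add' X Y := by
    simp only [Pi.add_apply, mul_add, add_mul, Finset.sum_add_distrib, Complex.add_re]
  map_smul' c X := by
    simp only [Pi.smul_apply, Complex.real_smul, RingHom.id_apply, smul_eq_mul,
      Complex.re_sum, Finset.mul_sum]
    refine Finset.sum_congr rfl fun i _ => Finset.sum_congr rfl fun j _ => ?_
    rw [← Complex.re_ofReal_mul]; ring_nf

lemma hermForm_rankOne (f u : κ → ℂ) : hermForm f (rankOne u) = ‖f ⬝ᵥ u‖ ^ 2 := by
  have h : ∑ i, ∑ j, f i * rankOne u i j * star (f j) = (f ⬝ᵥ u) * star (f ⬝ᵥ u) := by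
    simp only [dotProduct, star_sum, Finset.sum_mul_sum, rankOne, star_mul']
    exact Finset.sum_congr rfl fun i _ => Finset.sum_congr rfl fun j _ => by ring
  change (∑ i, ∑ j, f i * rankOne u i j * star (f j)).re = _
  rw [h, Complex.star_def, Complex.mul_conj']
  norm_cast

/-- The trace of an array, as a real linear functional. -/
noncomputable def reTrace : (κ → κ → ℂ) →ₗ[ℝ] ℝ where
  toFun X := (∑ i, X i i).re
  map_add' X Y := by simp [Finset.sum_add_distrib]
  map_smul' c X := by simp [Finset.mul_sum]

lemma reTrace_rankOne (u : κ → ℂ) : reTrace (rankOne u) = nsq u := by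
  simp only [reTrace, rankOne, nsq, LinearMap.coe_mk, AddHom.coe_mk, Complex.re_sum]
  refine Finset.sum_congr rfl fun i _ => ?_
  rw [Complex.star_def, Complex.mul_conj']
  norm_cast

lemma nsq_eq_re_dotProduct (v : κ → ℂ) : nsq v = (star v ⬝ᵥ v).re := by
  simp only [nsq, dotProduct, Complex.re_sum, Pi.star_apply]
  refine Finset.sum_congr rfl fun i _ => ?_
  rw [Complex.star_def, Complex.conj_mul']
  norm_cast

lemma re_apply_rankOne [DecidableEq κ] (f : (κ → κ → ℂ) →ₗ[ℂ] ℂ) (u : κ → ℂ) :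
    f (rankOne u) = star u ⬝ᵥ
      ((Matrix.of fun i j => f (Pi.single j (Pi.single i 1)) : Matrix κ κ ℂ) *ᵥ u) := by
  have h : rankOne u = ∑ i, ∑ j, (u i * star (u j)) • Pi.single i (Pi.single j (1 : ℂ)) := by
    funext a b
    simp [Finset.sum_apply, Pi.single_apply, rankOne, apply_ite, ite_apply]
  rw [h]
  simp only [map_sum, map_smul, dotProduct, mulVec, Finset.mul_sum, of_apply, smul_eq_mul,
    Pi.star_apply]
  rw [Finset.sum_comm]
  exact Finset.sum_congr rfl fun i _ => Finset.sum_congr rfl fun j _ => by ring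

open scoped MatrixOrder ComplexOrder in
/-- A functional that is positive on rank-one arrays is a nondegenerate square norm. -/
lemma exists_isUnit_re_apply_rankOne [DecidableEq κ] (f : (κ → κ → ℂ) →ₗ[ℂ] ℂ)
    (hf : ∀ u, u ≠ 0 → 0 < (f (rankOne u)).re) :
    ∃ S : Matrix κ κ ℂ, IsUnit S ∧ ∀ u, (f (rankOne u)).re = nsq (S *ᵥ u) := by
  set T₀ : Matrix κ κ ℂ := Matrix.of fun i j => f (Pi.single j (Pi.single i 1)) with hT₀
  set T : Matrix κ κ ℂ := (1 / 2 : ℂ) • (T₀ + T₀ᴴ) with hT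
  have hherm : T.IsHermitian := by
    simp [Matrix.IsHermitian, hT, add_comm]
  have hquad : ∀ u, star u ⬝ᵥ (T *ᵥ u) = (((f (rankOne u)).re : ℝ) : ℂ) := fun u => by
    have h1 : star u ⬝ᵥ (T₀ᴴ *ᵥ u) = star (star u ⬝ᵥ (T₀ *ᵥ u)) := by
      rw [star_dotProduct, star_mulVec, conjTranspose_conjTranspose, ← dotProduct_mulVec]
    rw [hT, smul_mulVec, add_mulVec, dotProduct_smul, dotProduct_add, h1,
      re_apply_rankOne, ← hT₀, Complex.re_eq_add_conj, Complex.star_def, smul_eq_mul]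
    ring
  have hpos : T.PosDef := .of_dotProduct_mulVec_pos hherm fun u hu => by
    rw [hquad]; exact_mod_cast hf u hu
  obtain ⟨S, hS⟩ := CStarAlgebra.nonneg_iff_eq_star_mul_self.1 hpos.posSemidef.nonneg
  refine ⟨S, ?_, fun u => ?_⟩
  · have := hpos.isUnit
    rw [hS] at this
    rw [Matrix.isUnit_iff_isUnit_det] at this ⊢
    rw [det_mul] at this
    exact isUnit_of_mul_isUnit_right this
  · rw [nsq_eq_re_dotProduct, star_mulVec, ← dotProduct_mulVec, mulVec_mulVec,
      ← Matrix.star_eq_conjTranspose, ← hS, hquad, Complex.ofReal_re]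

end Separation

/-- A matrix `G` dominated by `F` factors through `F` by a contraction. -/
lemma exists_contraction_mul_eq {α κ : Type*} [Fintype α] [Fintype κ]
    (F G : Matrix α κ ℂ) (h : ∀ f, nsq (G *ᵥ f) ≤ nsq (F *ᵥ f)) :
    ∃ V : Matrix α α ℂ, (∀ v, nsq (V *ᵥ v) ≤ nsq v) ∧ V * F = G := by
  classical
  let F' : (κ → ℂ) →ₗ[ℂ] EuclideanSpace ℂ α :=
    (WithLp.linearEquiv 2 ℂ (α → ℂ)).symm.toLinearMap ∘ₗ F.mulVecLin
  obtain ⟨s, hs⟩ := F'.rangeRestrict.exists_rightInverse_of_surjective F'.range_rangeRestrict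
  let P : EuclideanSpace ℂ α →ₗ[ℂ] LinearMap.range F' :=
    (LinearMap.range F').orthogonalProjectionOnto.toLinearMap
  let V' : (α → ℂ) →ₗ[ℂ] (α → ℂ) :=
    G.mulVecLin ∘ₗ s ∘ₗ P ∘ₗ (WithLp.linearEquiv 2 ℂ (α → ℂ)).symm.toLinearMap
  have hFs : ∀ y : LinearMap.range F', F' (s y) = y := fun y =>
    congrArg Subtype.val (LinearMap.congr_fun hs y)
  have hF' : ∀ f, ‖F' f‖ ^ 2 = nsq (F *ᵥ f) := fun f => (nsq_eq_norm_sq _).symm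
  refine ⟨LinearMap.toMatrix' V', fun v => ?_, ?_⟩
  · rw [LinearMap.toMatrix'_mulVec]
    refine (h _).trans ?_
    rw [← hF']
    change ‖F' (s (P (WithLp.toLp 2 v)))‖ ^ 2 ≤ nsq v
    rw [hFs, nsq_eq_norm_sq]
    gcongr
    exact Submodule.norm_orthogonalProjectionOnto_apply_le (LinearMap.range F') (WithLp.toLp 2 v)
  · refine Matrix.toLin'.injective (LinearMap.ext fun f => ?_)
    rw [Matrix.toLin'_mul, Matrix.toLin'_toMatrix', LinearMap.comp_apply, toLin'_apply,
      toLin'_apply]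
    have h1 : P (WithLp.toLp 2 (F *ᵥ f)) = ⟨F' f, f, rfl⟩ :=
      Submodule.orthogonalProjectionOnto_mem_subspace_eq_self (⟨F' f, f, rfl⟩ : LinearMap.range F')
    change G *ᵥ (s (P (WithLp.toLp 2 (F *ᵥ f)))) = _
    rw [h1, ← sub_eq_zero, ← mulVec_sub, ← nsq_eq_zero]
    refine le_antisymm ((h _).trans ?_) (nsq_nonneg _)
    rw [← hF', map_sub, hFs, sub_self]
    simp

/-- The ampliation `1 ⊗ L` of a matrix `L`. -/
def amp (ρ : Type*) [DecidableEq ρ] {α β : Type*} (L : Matrix α β ℂ) : Matrix (ρ × α) (ρ × β) ℂ :=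
  (1 : Matrix ρ ρ ℂ) ⊗ₖ L

lemma amp_mulVec {ρ α β : Type*} [Fintype ρ] [DecidableEq ρ] [Fintype β] (L : Matrix α β ℂ)
    (v : ρ × β → ℂ) (j : ρ) (i : α) :
    (amp ρ L *ᵥ v) (j, i) = (L *ᵥ fun t => v (j, t)) i := by
  simp [amp, mulVec, dotProduct, Fintype.sum_prod_type, one_apply]

lemma nsq_amp_mulVec {ρ α β : Type*} [Fintype ρ] [DecidableEq ρ] [Fintype α] [Fintype β]
    (L : Matrix α β ℂ) (v : ρ × β → ℂ) :
    nsq (amp ρ L *ᵥ v) = ∑ j, nsq (L *ᵥ fun t => v (j, t)) := by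
  simp only [nsq_prod, amp_mulVec]

section Separation

variable {ρ κ : Type*} [Fintype ρ] [Fintype κ]

/-- The defect `∑ⱼ vⱼ vⱼᴴ - (Δ v)ⱼ (Δ v)ⱼᴴ` of a block vector. -/
def defect (Δ : Matrix (ρ × κ) (ρ × κ) ℂ) (v : ρ × κ → ℂ) : κ → κ → ℂ :=
  ∑ j, (rankOne (fun t => v (j, t)) - rankOne fun t => (Δ *ᵥ v) (j, t))

lemma continuous_defect (Δ : Matrix (ρ × κ) (ρ × κ) ℂ) : Continuous (defect Δ) := by
  have h : Continuous fun v : ρ × κ → ℂ => Δ *ᵥ v := continuous_const.matrix_mulVec continuous_id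
  refine continuous_finsetSum _ fun j _ => .sub ?_ ?_
  · exact continuous_rankOne.comp (by fun_prop)
  · exact continuous_rankOne.comp (by fun_prop)

lemma defect_smul (Δ : Matrix (ρ × κ) (ρ × κ) ℂ) (c : ℂ) (v : ρ × κ → ℂ) :
    defect Δ (c • v) = (‖c‖ ^ 2 : ℝ) • defect Δ v := by
  simp only [defect, Finset.smul_sum, smul_sub, ← rankOne_smul, mulVec_smul]
  rfl

/-- `X` dominates a finite sum of defects, as a form on the dual space. -/
def DominatesDefects (Δ : Matrix (ρ × κ) (ρ × κ) ℂ) (X : κ → κ → ℂ) : Prop :=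
  ∃ (L : Type) (_ : Fintype L) (a : L → ρ × κ → ℂ),
    ∀ f, ∑ l, hermForm f (defect Δ (a l)) ≤ hermForm f X

lemma dominatesDefects_rankOne (Δ : Matrix (ρ × κ) (ρ × κ) ℂ) (u : κ → ℂ) :
    DominatesDefects Δ (rankOne u) :=
  ⟨Empty, inferInstance, nofun, fun f => by rw [hermForm_rankOne]; simp⟩

lemma dominatesDefects_defect (Δ : Matrix (ρ × κ) (ρ × κ) ℂ) (v : ρ × κ → ℂ) :
    DominatesDefects Δ (defect Δ v) :=
  ⟨Unit, inferInstance, fun _ => v, fun f => by simp⟩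

lemma DominatesDefects.add {Δ : Matrix (ρ × κ) (ρ × κ) ℂ} {X Y : κ → κ → ℂ}
    (hX : DominatesDefects Δ X) (hY : DominatesDefects Δ Y) : DominatesDefects Δ (X + Y) := by
  obtain ⟨L, _, a, ha⟩ := hX
  obtain ⟨M, _, b, hb⟩ := hY
  refine ⟨L ⊕ M, inferInstance, Sum.elim a b, fun f => ?_⟩
  rw [map_add, Fintype.sum_sum_type]
  exact add_le_add (ha f) (hb f)

lemma DominatesDefects.smul {Δ : Matrix (ρ × κ) (ρ × κ) ℂ} {X : κ → κ → ℂ}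
    (hX : DominatesDefects Δ X) {c : ℝ} (hc : 0 ≤ c) : DominatesDefects Δ (c • X) := by
  obtain ⟨L, _, a, ha⟩ := hX
  refine ⟨L, inferInstance, fun l => ((Real.sqrt c : ℝ) : ℂ) • a l, fun f => ?_⟩
  have h : ‖((Real.sqrt c : ℝ) : ℂ)‖ ^ 2 = c := by
    rw [Complex.norm_real, Real.norm_eq_abs, sq_abs, Real.sq_sqrt hc]
  simp only [defect_smul, h, map_smul, smul_eq_mul, ← Finset.mul_sum]
  exact mul_le_mul_of_nonneg_left (ha f) hc

lemma convex_dominatesDefects (Δ : Matrix (ρ × κ) (ρ × κ) ℂ) :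
    Convex ℝ {X | DominatesDefects Δ X} :=
  fun _ hX _ hY _ _ ha hb _ => (hX.smul ha).add (hY.smul hb)

variable [DecidableEq ρ] [DecidableEq κ]

/-- The Hahn–Banach step: if `w` is dominated by `e` in every Hilbert space norm on `ℂ^κ` for
which `Δ` is a strict contraction, then `e eᴴ - w wᴴ` dominates a finite sum of defects. -/
lemma dominatesDefects_of_forall_nsq_le [Nonempty κ] {Δ : Matrix (ρ × κ) (ρ × κ) ℂ}
    (hΔ : opNorm Δ < 1) (e w : κ → ℂ)
    (H : ∀ S : Matrix κ κ ℂ, IsUnit S →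
      (∀ v, v ≠ 0 → nsq (amp ρ S *ᵥ (Δ *ᵥ v)) < nsq (amp ρ S *ᵥ v)) →
      nsq (S *ᵥ w) ≤ nsq (S *ᵥ e)) :
    DominatesDefects Δ (rankOne e - rankOne w) := by
  set R := rankOne e - rankOne w with hR
  set s : Set (κ → κ → ℂ) := rankOne '' {u | nsq u = 1} ∪ defect Δ '' {v | nsq v = 1} with hs
  have hs_ne : s.Nonempty := by
    obtain ⟨c, -, hc⟩ := exists_smul_nsq_eq_one (one_ne_zero : (1 : κ → ℂ) ≠ 0)
    exact ⟨_, Or.inl ⟨_, hc, rfl⟩⟩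
  have hs_compact : IsCompact s :=
    (isCompact_nsq_sphere.image continuous_rankOne).union
      (isCompact_nsq_sphere.image (continuous_defect Δ))
  have hs_dom : ∀ X ∈ convexHull ℝ s, DominatesDefects Δ X := by
    refine fun X hX => convexHull_min ?_ (convex_dominatesDefects Δ) hX
    rintro _ (⟨u, -, rfl⟩ | ⟨v, -, rfl⟩)
    · exact dominatesDefects_rankOne Δ u
    · exact dominatesDefects_defect Δ v
  have hs_trace : ∀ X ∈ convexHull ℝ s, 0 < reTrace X := by
    refine fun X hX => convexHull_min (t := {X | 0 < reTrace X}) ?_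
      (convex_halfSpace_gt reTrace.isLinear 0) hX
    rintro _ (⟨u, hu, rfl⟩ | ⟨v, hv, rfl⟩)
    · change 0 < reTrace _
      rw [reTrace_rankOne, show nsq u = 1 from hu]; exact one_pos
    · obtain ⟨c, hc, hc1, hΔc⟩ := opNorm_lt_one_iff.1 hΔ
      have hv1 : nsq v = 1 := hv
      have h := hΔc v
      change 0 < reTrace _
      simp only [defect, map_sum, map_sub, reTrace_rankOne, Finset.sum_sub_distrib, ← nsq_prod]
      rw [hv1] at *
      linarith
  by_cases h0 : (0 : κ → κ → ℂ) ∈ convexHull ℝ (insert (-R) s)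
  · rw [convexHull_insert hs_ne, convexJoin_singleton_left] at h0
    obtain ⟨b, hb, α, β, hα, hβ, hαβ, h⟩ := Set.mem_iUnion₂.1 h0
    have hα0 : α ≠ 0 := by
      rintro rfl
      rw [zero_add] at hαβ
      subst hαβ
      have := hs_trace b hb
      simp at h
      simp [h] at this
    have hRb : R = (α⁻¹ * β) • b := by
      have : α • R = β • b := by
        rw [← sub_eq_zero, ← neg_eq_zero, ← h]; simp; abel
      rw [mul_smul, ← this, smul_smul, inv_mul_cancel₀ hα0, one_smul]
    rw [hRb]
    exact (hs_dom b hb).smul (by positivity)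
  · exfalso
    obtain ⟨f, u, hu0, hu⟩ := RCLike.geometric_hahn_banach_point_closed (𝕜 := ℂ)
      (convex_convexHull ℝ _)
      ((hs_compact.insert (-R)).convexHull_of_finiteDimensional).isClosed h0
    have hpos : ∀ X ∈ insert (-R) s, 0 < (f X).re := fun X hX => by
      have h1 := hu X (subset_convexHull ℝ _ hX)
      simp only [map_zero] at hu0
      exact hu0.trans h1
    obtain ⟨S, hS, hfS⟩ := exists_isUnit_re_apply_rankOne f.toLinearMap fun v hv => by
      obtain ⟨c, hc, hcv⟩ := exists_smul_nsq_eq_one hv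
      have h1 := hpos _ (Or.inr (Or.inl ⟨_, hcv, rfl⟩))
      rw [rankOne_smul, ← Complex.coe_smul, map_smul, smul_eq_mul, Complex.re_ofReal_mul] at h1
      exact pos_of_mul_pos_right h1 (by positivity)
    have hfS' : ∀ u, (f (rankOne u)).re = nsq (S *ᵥ u) := hfS
    have hw := H S hS fun v hv => by
      obtain ⟨c, hc, hcv⟩ := exists_smul_nsq_eq_one hv
      have h1 := hpos _ (Or.inr (Or.inr ⟨_, hcv, rfl⟩))
      rw [defect_smul, ← Complex.coe_smul, map_smul, smul_eq_mul, Complex.re_ofReal_mul] at h1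
      have h2 := pos_of_mul_pos_right h1 (by positivity)
      simp only [defect, map_sum, map_sub, Complex.re_sum, Complex.sub_re, hfS',
        Finset.sum_sub_distrib, ← nsq_amp_mulVec] at h2
      linarith
    have h1 := hpos _ (Or.inl rfl)
    rw [hR, map_neg, map_sub, Complex.neg_re, Complex.sub_re, hfS', hfS'] at h1
    linarith

end Separation

section Evaluation

variable {d m n : ℕ}

@[simp] lemma evalPoly_zero (x : MatTuple d n) : evalPoly 0 x = 0 := map_zero _
@[simp] lemma evalPoly_one (x : MatTuple d n) : evalPoly 1 x = 1 := map_one _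
lemma evalPoly_add (p q : FreeAlgebra ℂ (Fin d)) (x : MatTuple d n) :
    evalPoly (p + q) x = evalPoly p x + evalPoly q x := map_add _ _ _
lemma evalPoly_sub (p q : FreeAlgebra ℂ (Fin d)) (x : MatTuple d n) :
    evalPoly (p - q) x = evalPoly p x - evalPoly q x := map_sub _ _ _
lemma evalPoly_smul (c : ℂ) (p : FreeAlgebra ℂ (Fin d)) (x : MatTuple d n) :
    evalPoly (c • p) x = c • evalPoly p x := map_smul _ _ _
lemma evalPoly_mul (p q : FreeAlgebra ℂ (Fin d)) (x : MatTuple d n) :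
    evalPoly (p * q) x = evalPoly p x * evalPoly q x := map_mul _ _ _
lemma evalPoly_sum {ι : Type*} (s : Finset ι) (p : ι → FreeAlgebra ℂ (Fin d)) (x : MatTuple d n) :
    evalPoly (∑ i ∈ s, p i) x = ∑ i ∈ s, evalPoly (p i) x := map_sum _ _ _
@[simp] lemma evalPoly_algebraMap (c : ℂ) (x : MatTuple d n) :
    evalPoly (algebraMap ℂ _ c) x = algebraMap ℂ _ c := AlgHom.commutes _ _
@[simp] lemma evalPoly_ι (r : Fin d) (x : MatTuple d n) :
    evalPoly (FreeAlgebra.ι ℂ r) x = x r := FreeAlgebra.lift_ι_apply _ _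

lemma evalPoly_intertwine {x : MatTuple d m} {y : MatTuple d n} {L : Matrix (Fin m) (Fin n) ℂ}
    (h : ∀ r, x r * L = L * y r) (p : FreeAlgebra ℂ (Fin d)) :
    evalPoly p x * L = L * evalPoly p y := by
  induction p using FreeAlgebra.induction with
  | grade0 c =>
    rw [evalPoly_algebraMap, evalPoly_algebraMap, Algebra.algebraMap_eq_smul_one,
      Algebra.algebraMap_eq_smul_one]
    simp
  | grade1 r => simpa using h r
  | mul p q hp hq =>
    rw [evalPoly_mul, evalPoly_mul, Matrix.mul_assoc, hq, ← Matrix.mul_assoc, hp, Matrix.mul_assoc]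
  | add p q hp hq => rw [evalPoly_add, evalPoly_add, Matrix.add_mul, Matrix.mul_add, hp, hq]

/-- Evaluation of a matrix of free polynomials with arbitrary index types. -/
noncomputable def evalM {ρ σ : Type*} (P : Matrix ρ σ (FreeAlgebra ℂ (Fin d))) (x : MatTuple d n) :
    Matrix (ρ × Fin n) (σ × Fin n) ℂ :=
  fun a b => evalPoly (P a.1 b.1) x a.2 b.2

variable {ρ σ τ : Type*} [Fintype σ]

lemma evalM_intertwine [DecidableEq σ] [DecidableEq ρ] [Fintype ρ]
    {x : MatTuple d m} {y : MatTuple d n}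
    {L : Matrix (Fin m) (Fin n) ℂ} (h : ∀ r, x r * L = L * y r)
    (P : Matrix ρ σ (FreeAlgebra ℂ (Fin d))) :
    evalM P x * amp σ L = amp ρ L * evalM P y := by
  ext ⟨a, i⟩ ⟨b, j⟩
  have := congrFun (congrFun (evalPoly_intertwine h (P a b)) i) j
  simpa [evalM, amp, mul_apply, Fintype.sum_prod_type, one_apply] using this

end Evaluation

section Domain

variable {d J : ℕ} {δ : Matrix (Fin J) (Fin J) (FreeAlgebra ℂ (Fin d))}

lemma nsq_evalMat_lt {n : ℕ} {x : MatTuple d n} (hx : x ∈ Gdel δ n) {v : Fin J × Fin n → ℂ}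
    (hv : v ≠ 0) : nsq (evalMat δ x *ᵥ v) < nsq v := by
  obtain ⟨c, hc, hc1, h⟩ := opNorm_lt_one_iff.1 hx
  nlinarith [h v, nsq_pos hv]

lemma nsq_evalMat_le {n : ℕ} {x : MatTuple d n} (hx : x ∈ Gdel δ n) (v : Fin J × Fin n → ℂ) :
    nsq (evalMat δ x *ᵥ v) ≤ nsq v := by
  rcases eq_or_ne v 0 with rfl | hv
  · simp
  · exact (nsq_evalMat_lt hx hv).le

/-- A point that embeds isometrically into a direct sum of points of `G_δ` lies in `G_δ`. -/
lemma mem_Gdel_of_isometric {γ : Type*} [Fintype γ] {k : ℕ} {m : γ → ℕ}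
    {x : ∀ c, MatTuple d (m c)} {y : MatTuple d k} (L : ∀ c, Matrix (Fin (m c)) (Fin k) ℂ)
    (hx : ∀ c, x c ∈ Gdel δ (m c)) (hL : ∀ c r, x c r * L c = L c * y r)
    (hiso : ∀ v, ∑ c, nsq (L c *ᵥ v) = nsq v) : y ∈ Gdel δ k := by
  have hamp : ∀ v : Fin J × Fin k → ℂ, ∑ c, nsq (amp (Fin J) (L c) *ᵥ v) = nsq v := fun v => by
    simp only [nsq_amp_mulVec]
    rw [Finset.sum_comm]
    simp only [hiso, nsq_prod v]
  refine opNorm_lt_one_of_forall_lt fun v hv => ?_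
  have hstep : ∀ c, amp (Fin J) (L c) *ᵥ (evalMat δ y *ᵥ v) =
      evalMat δ (x c) *ᵥ (amp (Fin J) (L c) *ᵥ v) := fun c => by
    rw [mulVec_mulVec, mulVec_mulVec]
    exact congrArg (· *ᵥ v) (evalM_intertwine (hL c) δ).symm
  rw [← hamp v, ← hamp (evalMat δ y *ᵥ v)]
  simp only [hstep]
  have hne : ∃ c, amp (Fin J) (L c) *ᵥ v ≠ 0 := by
    by_contra! h0
    have := hamp v
    simp only [h0, nsq_zero, Finset.sum_const_zero] at this
    exact hv (nsq_eq_zero.1 this.symm)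
  obtain ⟨c, hc⟩ := hne
  exact Finset.sum_lt_sum (fun c _ => nsq_evalMat_le (hx c) _)
    ⟨c, Finset.mem_univ c, nsq_evalMat_lt (hx c) hc⟩

end Domain

section DirectSum

variable {m n : ℕ}

/-- The inclusion of the first summand. -/
def inclL (m n : ℕ) : Matrix (Fin (m + n)) (Fin m) ℂ :=
  (1 : Matrix (Fin (m + n)) (Fin (m + n)) ℂ).submatrix id (Fin.castAdd n)

/-- The inclusion of the second summand. -/
def inclR (m n : ℕ) : Matrix (Fin (m + n)) (Fin n) ℂ :=
  (1 : Matrix (Fin (m + n)) (Fin (m + n)) ℂ).submatrix id (Fin.natAdd m)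

lemma castAdd_ne_natAdd (i : Fin m) (j : Fin n) : Fin.castAdd n i ≠ Fin.natAdd m j := by
  simp only [ne_eq, Fin.ext_iff, Fin.val_castAdd, Fin.val_natAdd]; lia

lemma natAdd_ne_castAdd (i : Fin m) (j : Fin n) : Fin.natAdd m j ≠ Fin.castAdd n i :=
  (castAdd_ne_natAdd i j).symm

lemma eq_mdsum_iff {Z : Matrix (Fin (m + n)) (Fin (m + n)) ℂ} {A : Matrix (Fin m) (Fin m) ℂ}
    {B : Matrix (Fin n) (Fin n) ℂ} :
    Z = mdsum A B ↔ Z * inclL m n = inclL m n * A ∧ Z * inclR m n = inclR m n * B := by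
  constructor
  · rintro rfl
    refine ⟨?_, ?_⟩ <;> ext i t <;> refine Fin.addCases (fun i => ?_) (fun i => ?_) i <;>
      simp [inclL, inclR, mul_apply, one_apply, mdsum, castAdd_ne_natAdd, natAdd_ne_castAdd]
  · rintro ⟨hl, hr⟩
    ext i t
    have hl := fun t => congrFun (congrFun hl i) t
    have hr := fun t => congrFun (congrFun hr i) t
    revert hl hr
    refine Fin.addCases (fun i => ?_) (fun i => ?_) i <;>
      refine Fin.addCases (fun t => ?_) (fun t => ?_) t <;> intro hl hr
    · simpa [inclL, mul_apply, one_apply, mdsum] using hl t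
    · simpa [inclR, mul_apply, one_apply, mdsum, castAdd_ne_natAdd] using hr t
    · simpa [inclL, mul_apply, one_apply, mdsum, natAdd_ne_castAdd] using hl t
    · simpa [inclR, mul_apply, one_apply, mdsum] using hr t

lemma transpose_inclL_mul_mdsum (A : Matrix (Fin m) (Fin m) ℂ) (B : Matrix (Fin n) (Fin n) ℂ) :
    A * (inclL m n)ᵀ = (inclL m n)ᵀ * mdsum A B := by
  ext i t
  refine Fin.addCases (fun t => ?_) (fun t => ?_) t <;>
    simp [inclL, mul_apply, one_apply, mdsum, castAdd_ne_natAdd]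

lemma transpose_inclR_mul_mdsum (A : Matrix (Fin m) (Fin m) ℂ) (B : Matrix (Fin n) (Fin n) ℂ) :
    B * (inclR m n)ᵀ = (inclR m n)ᵀ * mdsum A B := by
  ext i t
  refine Fin.addCases (fun t => ?_) (fun t => ?_) t <;>
    simp [inclR, mul_apply, one_apply, mdsum, natAdd_ne_castAdd]

lemma nsq_inclL_mulVec (v : Fin m → ℂ) : nsq (inclL m n *ᵥ v) = nsq v := by
  simp [nsq, inclL, Fin.sum_univ_add, mulVec, dotProduct, one_apply, natAdd_ne_castAdd]

lemma nsq_inclR_mulVec (v : Fin n → ℂ) : nsq (inclR m n *ᵥ v) = nsq v := by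
  simp [nsq, inclR, Fin.sum_univ_add, mulVec, dotProduct, one_apply, castAdd_ne_natAdd]

lemma nsq_transpose_incl_mulVec (v : Fin (m + n) → ℂ) :
    nsq ((inclL m n)ᵀ *ᵥ v) + nsq ((inclR m n)ᵀ *ᵥ v) = nsq v := by
  simp [nsq, inclL, inclR, Fin.sum_univ_add, mulVec, dotProduct, one_apply]

variable {d J : ℕ} {δ : Matrix (Fin J) (Fin J) (FreeAlgebra ℂ (Fin d))}
  {x : MatTuple d m} {y : MatTuple d n}

lemma tdsum_mul_inclL (x : MatTuple d m) (y : MatTuple d n) (r : Fin d) :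
    tdsum x y r * inclL m n = inclL m n * x r := (eq_mdsum_iff.1 rfl).1

lemma tdsum_mul_inclR (x : MatTuple d m) (y : MatTuple d n) (r : Fin d) :
    tdsum x y r * inclR m n = inclR m n * y r := (eq_mdsum_iff.1 rfl).2

lemma tdsum_mem_Gdel_iff :
    tdsum x y ∈ Gdel δ (m + n) ↔ x ∈ Gdel δ m ∧ y ∈ Gdel δ n := by
  refine ⟨fun h => ⟨?_, ?_⟩, fun ⟨hx, hy⟩ => ?_⟩
  · exact mem_Gdel_of_isometric (γ := Unit) (fun _ => inclL m n) (fun _ => h)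
      (fun _ => tdsum_mul_inclL x y) fun v => by simp [nsq_inclL_mulVec]
  · exact mem_Gdel_of_isometric (γ := Unit) (fun _ => inclR m n) (fun _ => h)
      (fun _ => tdsum_mul_inclR x y) fun v => by simp [nsq_inclR_mulVec]
  · refine mem_Gdel_of_isometric (γ := Bool) (m := fun b => Bool.rec m n b)
      (x := fun b => Bool.rec x y b)
      (fun b => Bool.rec (inclL m n)ᵀ (inclR m n)ᵀ b) (fun b => ?_) (fun b => ?_) fun v => ?_
    · cases b
      · exact hx
      · exact hy
    · cases b
      · exact fun r => transpose_inclL_mul_mdsum _ _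
      · exact fun r => transpose_inclR_mul_mdsum _ _
    · rw [Fintype.sum_bool, add_comm]
      exact nsq_transpose_incl_mulVec v

/-- An nc-function on `G_δ` respects intertwiners. -/
lemma IsNCFn.intertwine {φ : ∀ n, MatTuple d n → Matrix (Fin n) (Fin n) ℂ}
    (hφ : IsNCFn (Gdel δ) φ) (hx : x ∈ Gdel δ m) (hy : y ∈ Gdel δ n)
    {L : Matrix (Fin m) (Fin n) ℂ} (hL : ∀ r, x r * L = L * y r) :
    φ m x * L = L * φ n y := by
  set e := (finSumFinEquiv : Fin m ⊕ Fin n ≃ Fin (m + n))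
  set s : Matrix (Fin (m + n)) (Fin (m + n)) ℂ := (fromBlocks 1 L 0 1).submatrix e.symm e.symm
    with hs
  have hunit : IsUnit s := by
    rw [Matrix.isUnit_iff_isUnit_det, hs, det_submatrix_equiv_self]
    simp
  have hinj : Function.Injective
      fun M : Matrix (Fin m ⊕ Fin n) (Fin m ⊕ Fin n) ℂ => M.submatrix e.symm e.symm :=
    (Matrix.reindex e e).injective
  have hcomm : ∀ (A : Matrix (Fin m) (Fin m) ℂ) (B : Matrix (Fin n) (Fin n) ℂ),
      mdsum A B * s = s * mdsum A B ↔ A * L = L * B := fun A B => by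
    change (fromBlocks A 0 0 B).submatrix e.symm e.symm * s =
      s * (fromBlocks A 0 0 B).submatrix e.symm e.symm ↔ _
    rw [hs, submatrix_mul_equiv, submatrix_mul_equiv, fromBlocks_multiply, fromBlocks_multiply,
      hinj.eq_iff, fromBlocks_inj]
    simp
  have hz := tdsum_mem_Gdel_iff.2 ⟨hx, hy⟩
  have hfix : (fun r => s⁻¹ * tdsum x y r * s) = tdsum x y := funext fun r => by
    have h1 : tdsum x y r * s = s * tdsum x y r := (hcomm _ _).2 (hL r)
    rw [Matrix.mul_assoc, h1, ← Matrix.mul_assoc,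
      nonsing_inv_mul _ ((Matrix.isUnit_iff_isUnit_det _).1 hunit), Matrix.one_mul]
  have h := hφ.map_sim (tdsum x y) s hunit hz (by rw [hfix]; exact hz)
  rw [hfix, hφ.map_dsum x y hx hy hz] at h
  refine (hcomm _ _).1 ?_
  conv_rhs => rw [h]
  rw [← Matrix.mul_assoc, ← Matrix.mul_assoc,
    mul_nonsing_inv _ ((Matrix.isUnit_iff_isUnit_det _).1 hunit), Matrix.one_mul]

end DirectSum

section PolynomialValues

variable {d J n : ℕ} {δ : Matrix (Fin J) (Fin J) (FreeAlgebra ℂ (Fin d))}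

/-- Evaluation of free polynomials at `x`, with values in the Hilbert–Schmidt space. -/
noncomputable def evalVec (x : MatTuple d n) :
    FreeAlgebra ℂ (Fin d) →ₗ[ℂ] EuclideanSpace ℂ (Fin n × Fin n) where
  toFun p := WithLp.toLp 2 fun a => evalPoly p x a.1 a.2
  map_add' p q := by ext a; simp [evalPoly_add]
  map_smul' c p := by ext a; simp [evalPoly_smul]

/-- Pointwise, an nc-function on `G_δ` takes the value of some free polynomial. -/
lemma IsNCFn.exists_evalPoly_eq {φ : ∀ n, MatTuple d n → Matrix (Fin n) (Fin n) ℂ}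
    (hφ : IsNCFn (Gdel δ) φ) {x : MatTuple d n} (hx : x ∈ Gdel δ n) :
    ∃ p, φ n x = evalPoly p x := by
  set E := LinearMap.range (evalVec x)
  set b := stdOrthonormalBasis ℂ E
  have hp : ∀ t, ∃ p, evalVec x p = b t := fun t => (b t).2
  choose p hp using hp
  set A : MatTuple d (Module.finrank ℂ E) := fun r s t =>
    b.repr ⟨evalVec x (FreeAlgebra.ι ℂ r * p t), LinearMap.mem_range_self _ _⟩ s with hA
  set L : Fin n → Matrix (Fin n) (Fin (Module.finrank ℂ E)) ℂ := fun c i t =>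
    (b t : EuclideanSpace ℂ (Fin n × Fin n)) (i, c) with hL
  have hLv : ∀ c v i, (L c *ᵥ v) i =
      ((∑ t, v t • b t : E) : EuclideanSpace ℂ (Fin n × Fin n)) (i, c) := fun c v i => by
    simp [hL, mulVec, dotProduct, mul_comm]
  have hrepr : ∀ (z : E) c i, (L c *ᵥ b.repr z) i =
      (z : EuclideanSpace ℂ (Fin n × Fin n)) (i, c) := fun z c i => by
    rw [hLv, b.sum_repr]
  have hiso : ∀ v, ∑ c, nsq (L c *ᵥ v) = nsq v := fun v => by
    rw [nsq_eq_norm_sq v, ← b.repr.symm.norm_map, ← b.sum_repr_symm]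
    have hnorm := EuclideanSpace.norm_sq_eq
      ((∑ t, v t • b t : E) : EuclideanSpace ℂ (Fin n × Fin n))
    change ‖(∑ t, v t • b t : E)‖ ^ 2 = _ at hnorm
    rw [hnorm, Fintype.sum_prod_type_right]
    simp only [nsq, hLv]
  have hcomm : ∀ c r, x r * L c = L c * A r := fun c r => by
    ext i t
    have h := hrepr ⟨evalVec x (FreeAlgebra.ι ℂ r * p t), LinearMap.mem_range_self _ _⟩ c i
    change (L c * A r) i t = evalPoly (FreeAlgebra.ι ℂ r * p t) x i c at h
    rw [h, evalPoly_mul, evalPoly_ι, mul_apply, mul_apply]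
    refine Finset.sum_congr rfl fun j _ => ?_
    rw [hL]
    simp only [← hp]
    rfl
  have hAmem : A ∈ Gdel δ _ := mem_Gdel_of_isometric L (fun _ => hx) hcomm hiso
  set q := b.repr ⟨evalVec x 1, LinearMap.mem_range_self _ _⟩
  have hq : ∀ c i, (L c *ᵥ q) i = evalPoly 1 x i c := hrepr _
  obtain ⟨P, hP⟩ := (∑ t, (φ _ A *ᵥ q) t • b t : E).2
  refine ⟨P, ?_⟩
  ext i c
  have h1 : (φ n x * L c) *ᵥ q = (L c * φ _ A) *ᵥ q :=
    congrArg (· *ᵥ (q : Fin _ → ℂ)) (hφ.intertwine hx hAmem (hcomm c))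
  have h2 := congrFun h1 i
  rw [← mulVec_mulVec, ← mulVec_mulVec, hLv, ← hP] at h2
  have h3 : L c *ᵥ q = fun j => (1 : Matrix (Fin n) (Fin n) ℂ) j c := funext fun j => by
    rw [hq, evalPoly_one]
  rw [h3] at h2
  change _ = evalPoly P x i c at h2
  rw [← h2]
  simp [mulVec, dotProduct, one_apply]

/-- Values of a function of the unit ball on the variety are values of one polynomial. -/
lemma exists_evalPoly_of_memBallHinf {φ : ∀ n, MatTuple d n → Matrix (Fin n) (Fin n) ℂ}
    (hφ : MemBallHinf (Gdel δ) φ) {Λ : MatTuple d n} (hΛ : Λ ∈ Gdel δ n) :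
    ∃ p₀ : FreeAlgebra ℂ (Fin d), evalPoly p₀ Λ = φ n Λ ∧
      ∀ m, ∀ x ∈ VLam Λ m ∩ Gdel δ m, opNorm (evalPoly p₀ x) ≤ 1 := by
  obtain ⟨_, δ₁, hΛ₁, -, hnc₁, -⟩ := hφ.1 n Λ hΛ
  obtain ⟨p₀, hp₀⟩ := hnc₁.exists_evalPoly_eq hΛ₁
  refine ⟨p₀, hp₀.symm, fun m x ⟨hxV, hx⟩ => ?_⟩
  obtain ⟨_, δ₂, hz₂, -, hnc₂, -⟩ := hφ.1 _ _ (tdsum_mem_Gdel_iff.2 ⟨hΛ, hx⟩)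
  obtain ⟨q, hq⟩ := hnc₂.exists_evalPoly_eq hz₂
  obtain ⟨hΛ₂, hx₂⟩ := tdsum_mem_Gdel_iff.1 hz₂
  have hsum : mdsum (φ n Λ) (φ m x) = mdsum (evalPoly q Λ) (evalPoly q x) := by
    rw [← hnc₂.map_dsum Λ x hΛ₂ hx₂ hz₂, hq]
    exact eq_mdsum_iff.2 ⟨evalPoly_intertwine (tdsum_mul_inclL Λ x) q,
      evalPoly_intertwine (tdsum_mul_inclR Λ x) q⟩
  obtain ⟨hqΛ, -, -, hqx⟩ := fromBlocks_inj.1 ((Matrix.reindex _ _).injective hsum)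
  have hsub : evalPoly (q - p₀) x = 0 := hxV _ (by rw [evalPoly_sub, ← hqΛ, hp₀, sub_self])
  rw [evalPoly_sub, sub_eq_zero, ← hqx] at hsub
  rw [← hsub]
  exact hφ.2 m x hx

end PolynomialValues

section Transfer

variable {d m n : ℕ} {K : Type*} [Fintype K]

/-- The ampliation `C ⊗ 1` acting on the left tensor factor. -/
noncomputable def blowUp (m : ℕ) {α β : Type*} (C : Matrix α β ℂ) :
    Matrix (α × Fin m) (β × Fin m) ℂ := C ⊗ₖ 1

lemma blowUp_mulVec {α β : Type*} [Fintype β] (C : Matrix α β ℂ) (v : β × Fin m → ℂ)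
    (a : α) (i : Fin m) :
    (blowUp m C *ᵥ v) (a, i) = (C *ᵥ fun b => v (b, i)) a := by
  simp [blowUp, mulVec, dotProduct, Fintype.sum_prod_type, one_apply]

lemma blowUp_mul_apply {α β γ : Type*} [Fintype β] (C : Matrix α β ℂ)
    (G : Matrix (β × Fin m) γ ℂ) (a : α) (i : Fin m) (c : γ) :
    (blowUp m C * G) (a, i) c = (C *ᵥ fun b => G (b, i) c) a :=
  blowUp_mulVec C (fun b => G b c) a i

lemma blowUp_mul_amp {α β : Type*} [Fintype α] [Fintype β] [DecidableEq α] [DecidableEq β]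
    (C : Matrix α β ℂ) (L : Matrix (Fin m) (Fin n) ℂ) :
    blowUp m C * amp β L =
      amp α L * blowUp n C := by
  simp only [amp, blowUp, ← mul_kronecker_mul, Matrix.one_mul, Matrix.mul_one]

lemma nsq_colligation_le {V : Matrix (Unit ⊕ K) (Unit ⊕ K) ℂ} (hV : ∀ v, nsq (V *ᵥ v) ≤ nsq v)
    (u : Unit × Fin m → ℂ) (g : K × Fin m → ℂ) :
    nsq (blowUp m V.toBlocks₁₁ *ᵥ u +
        blowUp m V.toBlocks₁₂ *ᵥ g) +
      nsq (blowUp m V.toBlocks₂₁ *ᵥ u +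
        blowUp m V.toBlocks₂₂ *ᵥ g) ≤ nsq u + nsq g := by
  simp only [nsq_prod_right, ← Finset.sum_add_distrib]
  refine Finset.sum_le_sum fun i _ => ?_
  have h := hV (Sum.elim (fun a => u (a, i)) fun k => g (k, i))
  rw [← fromBlocks_toBlocks V, fromBlocks_mulVec, nsq_sum_type, nsq_sum_type] at h
  simpa only [Pi.add_apply, blowUp_mulVec, Function.comp_def, Sum.elim_inl, Sum.elim_inr]
    using h

variable [DecidableEq K]

/-- `1 - V₂₂ P(x)`, the matrix inverted in the transfer function of the colligation `V`. -/
noncomputable def pencil (V : Matrix (Unit ⊕ K) (Unit ⊕ K) ℂ)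
    (P : Matrix K K (FreeAlgebra ℂ (Fin d))) (x : MatTuple d m) :
    Matrix (K × Fin m) (K × Fin m) ℂ :=
  1 - blowUp m V.toBlocks₂₂ * evalM P x

/-- The transfer function `V₁₁ + V₁₂ P(x) (1 - V₂₂ P(x))⁻¹ V₂₁` of the colligation `V`. -/
noncomputable def transferBlock (V : Matrix (Unit ⊕ K) (Unit ⊕ K) ℂ)
    (P : Matrix K K (FreeAlgebra ℂ (Fin d))) (x : MatTuple d m) :
    Matrix (Unit × Fin m) (Unit × Fin m) ℂ :=
  blowUp m V.toBlocks₁₁ +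
    blowUp m V.toBlocks₁₂ * (evalM P x * ((pencil V P x)⁻¹ * blowUp m V.toBlocks₂₁))

/-- The transfer function as a graded function. -/
noncomputable def transfer (V : Matrix (Unit ⊕ K) (Unit ⊕ K) ℂ)
    (P : Matrix K K (FreeAlgebra ℂ (Fin d))) (m : ℕ) (x : MatTuple d m) :
    Matrix (Fin m) (Fin m) ℂ :=
  (transferBlock V P x).submatrix (Prod.mk ()) (Prod.mk ())

variable {V : Matrix (Unit ⊕ K) (Unit ⊕ K) ℂ} {P : Matrix K K (FreeAlgebra ℂ (Fin d))}

lemma isUnit_pencil (hV : ∀ v, nsq (V *ᵥ v) ≤ nsq v) {x : MatTuple d m}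
    (hx : ∀ v ≠ 0, nsq (evalM P x *ᵥ v) < nsq v) : IsUnit (pencil V P x) := by
  rw [← mulVec_injective_iff_isUnit, ← coe_mulVecLin, injective_iff_map_eq_zero]
  intro h hh
  by_contra hne
  have hfix : blowUp m V.toBlocks₂₂ *ᵥ (evalM P x *ᵥ h) = h := by
    rw [mulVecLin_apply, pencil, sub_mulVec, one_mulVec, sub_eq_zero, ← mulVec_mulVec] at hh
    exact hh.symm
  have hle := nsq_colligation_le hV 0 (evalM P x *ᵥ h)
  simp only [mulVec_zero, zero_add, hfix, nsq_zero] at hle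
  linarith [hx h hne, nsq_nonneg (blowUp m V.toBlocks₁₂ *ᵥ
    (evalM P x *ᵥ h))]

lemma pencil_mul_inv_mul {β : Type*} (hV : ∀ v, nsq (V *ᵥ v) ≤ nsq v) {x : MatTuple d m}
    (hx : ∀ v ≠ 0, nsq (evalM P x *ᵥ v) < nsq v) (C : Matrix (K × Fin m) β ℂ) :
    pencil V P x * ((pencil V P x)⁻¹ * C) = C := by
  rw [mul_nonsing_inv_cancel_left _ _ ((isUnit_iff_isUnit_det _).1 (isUnit_pencil hV hx))]

lemma pencil_inv_mul_mul {β : Type*} (hV : ∀ v, nsq (V *ᵥ v) ≤ nsq v) {x : MatTuple d m}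
    (hx : ∀ v ≠ 0, nsq (evalM P x *ᵥ v) < nsq v) (C : Matrix (K × Fin m) β ℂ) :
    (pencil V P x)⁻¹ * (pencil V P x * C) = C := by
  rw [nonsing_inv_mul_cancel_left _ _ ((isUnit_iff_isUnit_det _).1 (isUnit_pencil hV hx))]

lemma transfer_intertwine (hV : ∀ v, nsq (V *ᵥ v) ≤ nsq v) {x : MatTuple d m} {y : MatTuple d n}
    (hx : ∀ v ≠ 0, nsq (evalM P x *ᵥ v) < nsq v) (hy : ∀ v ≠ 0, nsq (evalM P y *ᵥ v) < nsq v)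
    {L : Matrix (Fin m) (Fin n) ℂ} (hL : ∀ r, x r * L = L * y r) :
    transfer V P m x * L = L * transfer V P n y := by
  have hpencil : pencil V P x * amp K L = amp K L * pencil V P y := by
    rw [pencil, pencil, Matrix.sub_mul, Matrix.mul_sub, Matrix.one_mul, Matrix.mul_one,
      Matrix.mul_assoc, evalM_intertwine hL, ← Matrix.mul_assoc, blowUp_mul_amp,
      Matrix.mul_assoc]
  have hinv : (pencil V P x)⁻¹ * amp K L = amp K L * (pencil V P y)⁻¹ := by
    have h := pencil_inv_mul_mul hV hx (amp K L * (pencil V P y)⁻¹)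
    rwa [← Matrix.mul_assoc (pencil V P x), hpencil, Matrix.mul_assoc (amp K L),
      mul_nonsing_inv _ ((isUnit_iff_isUnit_det _).1 (isUnit_pencil hV hy)),
      Matrix.mul_one] at h
  have hblock : transferBlock V P x * amp Unit L = amp Unit L * transferBlock V P y := by
    simp only [transferBlock, Matrix.add_mul, Matrix.mul_add, Matrix.mul_assoc,
      blowUp_mul_amp]
    rw [← Matrix.mul_assoc (pencil V P x)⁻¹, hinv, Matrix.mul_assoc,
      ← Matrix.mul_assoc (evalM P x), evalM_intertwine hL, Matrix.mul_assoc,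
      ← Matrix.mul_assoc _ (amp K L), blowUp_mul_amp, Matrix.mul_assoc]
  ext i t
  have h := congrFun (congrFun hblock ((), i)) ((), t)
  simpa [transfer, amp, mul_apply, Fintype.sum_prod_type] using h

lemma opNorm_transfer_le (hV : ∀ v, nsq (V *ᵥ v) ≤ nsq v) {x : MatTuple d m}
    (hx : ∀ v ≠ 0, nsq (evalM P x *ᵥ v) < nsq v) : opNorm (transfer V P m x) ≤ 1 := by
  rw [opNorm_le_iff zero_le_one]
  intro u
  set u' : Unit × Fin m → ℂ := fun a => u a.2
  set h := ((pencil V P x)⁻¹ * blowUp m V.toBlocks₂₁) *ᵥ u' with hh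
  have hout : nsq (transfer V P m x *ᵥ u) = nsq (transferBlock V P x *ᵥ u') := by
    simp [nsq, transfer, mulVec, dotProduct, Fintype.sum_prod_type, u']
  have hu : nsq u' = nsq u := by simp [nsq, Fintype.sum_prod_type, u']
  have hstate : blowUp m V.toBlocks₂₁ *ᵥ u' +
      blowUp m V.toBlocks₂₂ *ᵥ (evalM P x *ᵥ h) = h := by
    rw [← eq_sub_iff_add_eq, mulVec_mulVec, ← pencil_mul_inv_mul hV hx (blowUp m V.toBlocks₂₁),
      ← mulVec_mulVec, hh.symm, pencil, sub_mulVec, one_mulVec]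
  have houtput : transferBlock V P x *ᵥ u' =
      blowUp m V.toBlocks₁₁ *ᵥ u' +
        blowUp m V.toBlocks₁₂ *ᵥ (evalM P x *ᵥ h) := by
    rw [transferBlock, add_mulVec, hh, mulVec_mulVec, mulVec_mulVec, Matrix.mul_assoc]
  have hle := nsq_colligation_le hV u' (evalM P x *ᵥ h)
  rw [hstate, ← houtput] at hle
  have hlt : nsq (evalM P x *ᵥ h) ≤ nsq h := by
    rcases eq_or_ne h 0 with h0 | h0
    · simp [h0]
    · exact (hx h h0).le
  rw [hout, ← hu]
  linarith

lemma memBallHinf_transfer {J : ℕ} {δ : Matrix (Fin J) (Fin J) (FreeAlgebra ℂ (Fin d))}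
    (hV : ∀ v, nsq (V *ᵥ v) ≤ nsq v)
    (hP : ∀ m, ∀ x ∈ Gdel δ m, ∀ v ≠ 0, nsq (evalM P x *ᵥ v) < nsq v) :
    MemBallHinf (Gdel δ) (transfer V P) := by
  have hbdd : BddBy (Gdel δ) (transfer V P) 1 := fun m x hx => opNorm_transfer_le hV (hP m x hx)
  refine ⟨fun m x hx => ⟨J, δ, hx, fun _ => subset_rfl, ⟨?_, ?_⟩, 1, hbdd⟩, hbdd⟩
  · intro m n x y hx hy hz
    exact eq_mdsum_iff.2
      ⟨transfer_intertwine hV (hP _ _ hz) (hP _ _ hx) (tdsum_mul_inclL x y),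
        transfer_intertwine hV (hP _ _ hz) (hP _ _ hy) (tdsum_mul_inclR x y)⟩
  · intro n x s hs hx hy
    have hdet := (isUnit_iff_isUnit_det _).1 hs
    have h := transfer_intertwine hV (hP _ _ hx) (hP _ _ hy) (L := s) fun r => by
      rw [Matrix.mul_assoc, mul_nonsing_inv_cancel_left _ _ hdet]
    rw [Matrix.mul_assoc, h, nonsing_inv_mul_cancel_left _ _ hdet]

lemma transfer_eq_of_colligation (hV : ∀ v, nsq (V *ᵥ v) ≤ nsq v) {x : MatTuple d m}
    (hx : ∀ v ≠ 0, nsq (evalM P x *ᵥ v) < nsq v) {W : Matrix (Fin m) (Fin m) ℂ}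
    {H : Matrix (K × Fin m) (Fin m) ℂ}
    (hsys : ∀ i c, V *ᵥ Sum.elim (fun _ => (1 : Matrix (Fin m) (Fin m) ℂ) i c)
        (fun k => (evalM P x * H) (k, i) c) = Sum.elim (fun _ => W i c) fun k => H (k, i) c) :
    transfer V P m x = W := by
  set H' : Matrix (K × Fin m) (Unit × Fin m) ℂ := H.submatrix id Prod.snd
  have hentry : ∀ i c, (V.toBlocks₁₁ *ᵥ fun _ => (1 : Matrix (Fin m) (Fin m) ℂ) i c) () +
        (V.toBlocks₁₂ *ᵥ fun k => (evalM P x * H) (k, i) c) () = W i c ∧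
      ∀ k, (V.toBlocks₂₁ *ᵥ fun _ => (1 : Matrix (Fin m) (Fin m) ℂ) i c) k +
        (V.toBlocks₂₂ *ᵥ fun k => (evalM P x * H) (k, i) c) k = H (k, i) c := fun i c => by
    have h := hsys i c
    rw [← fromBlocks_toBlocks V, fromBlocks_mulVec] at h
    exact ⟨congrFun h (Sum.inl ()), fun k => congrFun h (Sum.inr k)⟩
  have hstate : pencil V P x * H' = blowUp m V.toBlocks₂₁ := by
    ext ⟨k, i⟩ ⟨⟨⟩, c⟩
    rw [pencil, Matrix.sub_mul, Matrix.one_mul, Matrix.mul_assoc, Matrix.sub_apply,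
      blowUp_mul_apply]
    change H (k, i) c - (V.toBlocks₂₂ *ᵥ fun k => (evalM P x * H) (k, i) c) k = _
    rw [← (hentry i c).2 k, add_sub_cancel_right]
    simp [blowUp, mulVec, dotProduct]
  have hH : (pencil V P x)⁻¹ * blowUp m V.toBlocks₂₁ = H' := by
    rw [← hstate, pencil_inv_mul_mul hV hx]
  ext i c
  rw [← (hentry i c).1, transfer, transferBlock, hH, submatrix_apply,
    Matrix.add_apply, blowUp_mul_apply]
  congr 1
  simp [blowUp, mulVec, dotProduct]

end Transfer

section Realization

variable {d J n m : ℕ} {δ : Matrix (Fin J) (Fin J) (FreeAlgebra ℂ (Fin d))}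

lemma evalM_kronecker_one_mulVec {L : Type*} [Fintype L] [DecidableEq L] (x : MatTuple d m)
    (h : (Fin J × L) × Fin m → ℂ) (j : Fin J) (l : L) (i : Fin m) :
    (evalM (δ ⊗ₖ (1 : Matrix L L (FreeAlgebra ℂ (Fin d)))) x *ᵥ h) ((j, l), i) =
      (evalMat δ x *ᵥ fun a => h ((a.1, l), a.2)) (j, i) := by
  simp only [evalM, evalMat, mulVec, dotProduct, Fintype.sum_prod_type, kroneckerMap_apply,
    one_apply, evalPoly_mul]
  refine Finset.sum_congr rfl fun j' _ => ?_
  rw [Finset.sum_comm]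
  refine Finset.sum_congr rfl fun i' _ => ?_
  rw [Finset.sum_eq_single l]
  · simp
  · intro l' _ hl
    simp [Ne.symm hl]
  · simp

lemma nsq_evalM_kronecker_one_lt {L : Type*} [Fintype L] [DecidableEq L] {x : MatTuple d m}
    (hx : x ∈ Gdel δ m) {v : (Fin J × L) × Fin m → ℂ} (hv : v ≠ 0) :
    nsq (evalM (δ ⊗ₖ (1 : Matrix L L (FreeAlgebra ℂ (Fin d)))) x *ᵥ v) < nsq v := by
  have hsplit : ∀ u : (Fin J × L) × Fin m → ℂ,
      nsq u = ∑ l, nsq fun a : Fin J × Fin m => u ((a.1, l), a.2) := fun u => by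
    simp only [nsq, Fintype.sum_prod_type]
    exact Finset.sum_comm
  obtain ⟨⟨⟨j, l⟩, i⟩, hne⟩ := Function.ne_iff.1 hv
  simp only [hsplit, evalM_kronecker_one_mulVec, Prod.mk.eta]
  exact Finset.sum_lt_sum (fun l _ => nsq_evalMat_le hx _)
    ⟨l, Finset.mem_univ l, nsq_evalMat_lt hx fun h => hne (congrFun h (j, i))⟩

/-- The matrix extracting the `c`-th column of a flattened `n × n` matrix. -/
def colProj (n : ℕ) (c : Fin n) : Matrix (Fin n) (Fin (n * n)) ℂ :=
  fun i t => if finProdFinEquiv (i, c) = t then 1 else 0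

lemma colProj_mulVec (c : Fin n) (v : Fin (n * n) → ℂ) (i : Fin n) :
    (colProj n c *ᵥ v) i = v (finProdFinEquiv (i, c)) := by
  simp [colProj, mulVec, dotProduct]

lemma sum_nsq_colProj_mulVec (v : Fin (n * n) → ℂ) : ∑ c, nsq (colProj n c *ᵥ v) = nsq v := by
  simp only [nsq, colProj_mulVec]
  rw [← Fintype.sum_prod_type_right fun a : Fin n × Fin n => ‖v (finProdFinEquiv a)‖ ^ 2]
  exact finProdFinEquiv.sum_comp fun t => ‖v t‖ ^ 2

/-- The tuple acting by left multiplication by `Λ` on flattened `n × n` matrices. -/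
noncomputable def leftTuple (Λ : MatTuple d n) : MatTuple d (n * n) :=
  fun r => reindex finProdFinEquiv finProdFinEquiv (Λ r ⊗ₖ (1 : Matrix (Fin n) (Fin n) ℂ))

lemma mul_colProj (Λ : MatTuple d n) (c : Fin n) (r : Fin d) :
    Λ r * colProj n c = colProj n c * leftTuple Λ r := by
  ext i t
  obtain ⟨⟨i', c'⟩, rfl⟩ := finProdFinEquiv.surjective t
  change _ = (colProj n c *ᵥ fun s => leftTuple Λ r s (finProdFinEquiv (i', c'))) i
  rw [colProj_mulVec]
  by_cases h : c = c' <;> simp [colProj, leftTuple, mul_apply, one_apply, h]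

lemma leftTuple_mem_Gdel {Λ : MatTuple d n} (hΛ : Λ ∈ Gdel δ n) :
    leftTuple Λ ∈ Gdel δ (n * n) :=
  mem_Gdel_of_isometric (colProj n) (fun _ => hΛ) (mul_colProj Λ) sum_nsq_colProj_mulVec

lemma evalPoly_leftTuple_mulVec (p : FreeAlgebra ℂ (Fin d)) (Λ : MatTuple d n)
    (v : Fin (n * n) → ℂ) (i c : Fin n) :
    (evalPoly p (leftTuple Λ) *ᵥ v) (finProdFinEquiv (i, c)) =
      (evalPoly p Λ *ᵥ (colProj n c *ᵥ v)) i := by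
  rw [← colProj_mulVec c (_ *ᵥ v), mulVec_mulVec, mulVec_mulVec,
    evalPoly_intertwine (mul_colProj Λ c)]

lemma leftTuple_mem_VLam (Λ : MatTuple d n) : leftTuple Λ ∈ VLam Λ (n * n) := by
  intro p hp
  refine ext_of_mulVec_single fun s => ?_
  ext t
  obtain ⟨⟨i, c⟩, rfl⟩ := finProdFinEquiv.surjective t
  rw [evalPoly_leftTuple_mulVec, hp]
  simp

/-- The columns of `1` and of `p₀(Λ)`, flattened, satisfy the hypothesis of the cone argument. -/
lemma nsq_mulVec_le_of_similar {Λ : MatTuple d n} {p₀ : FreeAlgebra ℂ (Fin d)}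
    (hp₀ : ∀ m, ∀ x ∈ VLam Λ m ∩ Gdel δ m, opNorm (evalPoly p₀ x) ≤ 1)
    {S : Matrix (Fin (n * n)) (Fin (n * n)) ℂ} (hS : IsUnit S)
    (hlt : ∀ v ≠ 0, nsq (amp (Fin J) S *ᵥ (evalMat δ (leftTuple Λ) *ᵥ v)) <
      nsq (amp (Fin J) S *ᵥ v)) (u : Fin (n * n) → ℂ) :
    nsq (S *ᵥ (evalPoly p₀ (leftTuple Λ) *ᵥ u)) ≤ nsq (S *ᵥ u) := by
  have hdet := (isUnit_iff_isUnit_det _).1 hS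
  set y : MatTuple d (n * n) := fun r => S * leftTuple Λ r * S⁻¹ with hy
  have hcomm : ∀ r, y r * S = S * leftTuple Λ r := fun r =>
    nonsing_inv_mul_cancel_right _ _ hdet
  have hyV : y ∈ VLam Λ (n * n) := fun p hp => by
    have h := evalPoly_intertwine hcomm p
    rw [leftTuple_mem_VLam Λ p hp, Matrix.mul_zero] at h
    exact hS.mul_left_eq_zero.1 h
  have hyG : y ∈ Gdel δ (n * n) := by
    refine opNorm_lt_one_of_forall_lt fun z hz => ?_
    set v := amp (Fin J) S⁻¹ *ᵥ z with hv
    have hzv : amp (Fin J) S *ᵥ v = z := by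
      rw [hv, mulVec_mulVec, amp, amp, ← mul_kronecker_mul, Matrix.one_mul,
        mul_nonsing_inv _ hdet, one_kronecker_one, one_mulVec]
    have hv0 : v ≠ 0 := by
      intro h0
      rw [h0, mulVec_zero] at hzv
      exact hz hzv.symm
    have h := hlt v hv0
    rw [mulVec_mulVec] at h
    rw [show amp (Fin J) S * evalMat δ (leftTuple Λ) = evalMat δ y * amp (Fin J) S from
      (evalM_intertwine hcomm δ).symm] at h
    rwa [← mulVec_mulVec, hzv] at h
  have h := (opNorm_le_iff zero_le_one).1 (hp₀ _ y ⟨hyV, hyG⟩) (S *ᵥ u)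
  rwa [mulVec_mulVec, evalPoly_intertwine hcomm, ← mulVec_mulVec, one_pow, one_mul] at h

/-- A polynomial bounded by one on the variety agrees at `Λ` with a function of the unit ball. -/
lemma exists_memBallHinf_of_evalPoly (hn : 0 < n) {Λ : MatTuple d n} (hΛ : Λ ∈ Gdel δ n)
    {p₀ : FreeAlgebra ℂ (Fin d)}
    (hp₀ : ∀ m, ∀ x ∈ VLam Λ m ∩ Gdel δ m, opNorm (evalPoly p₀ x) ≤ 1) :
    ∃ φ : ∀ m, MatTuple d m → Matrix (Fin m) (Fin m) ℂ,
      MemBallHinf (Gdel δ) φ ∧ φ n Λ = evalPoly p₀ Λ := by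
  classical
  have : Nonempty (Fin (n * n)) := ⟨⟨0, Nat.mul_pos hn hn⟩⟩
  set flat : Matrix (Fin n) (Fin n) ℂ → Fin (n * n) → ℂ := fun A t =>
    A (finProdFinEquiv.symm t).1 (finProdFinEquiv.symm t).2 with hflat
  have hflat_apply : ∀ A i c, flat A (finProdFinEquiv (i, c)) = A i c := fun A i c => by
    simp only [hflat, Equiv.symm_apply_apply]
  have hw : evalPoly p₀ (leftTuple Λ) *ᵥ flat 1 = flat (evalPoly p₀ Λ) := by
    ext t
    obtain ⟨⟨i, c⟩, rfl⟩ := finProdFinEquiv.surjective t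
    have hcol : colProj n c *ᵥ flat 1 = fun j => (1 : Matrix (Fin n) (Fin n) ℂ) j c :=
      funext fun j => by rw [colProj_mulVec, hflat_apply]
    rw [evalPoly_leftTuple_mulVec, hflat_apply, hcol]
    simp [mulVec, dotProduct, one_apply]
  set Δ := evalMat δ (leftTuple Λ)
  obtain ⟨L, _, a, ha⟩ := dominatesDefects_of_forall_nsq_le (leftTuple_mem_Gdel hΛ) (flat 1)
    (flat (evalPoly p₀ Λ)) fun S hS hlt => by
      rw [← hw]
      exact nsq_mulVec_le_of_similar hp₀ hS hlt _
  obtain ⟨V, hV, hVF⟩ := exists_contraction_mul_eq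
    (Matrix.of (Sum.elim (fun _ : Unit => flat 1)
      fun (k : Fin J × L) t => (Δ *ᵥ a k.2) (k.1, t)))
    (Matrix.of (Sum.elim (fun _ : Unit => flat (evalPoly p₀ Λ))
      fun (k : Fin J × L) t => a k.2 (k.1, t))) fun f => by
      have h := ha f
      simp only [defect, map_sum, map_sub, hermForm_rankOne, Finset.sum_sub_distrib] at h
      rw [nsq_sum_type, nsq_sum_type]
      have hentry : ∀ (g : Unit ⊕ Fin J × L → Fin (n * n) → ℂ) s,
          (Matrix.of g *ᵥ f) s = f ⬝ᵥ g s := fun g s => dotProduct_comm _ _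
      simp only [nsq, Fintype.sum_prod_type_right, Finset.univ_unique, Finset.sum_singleton,
        hentry, Sum.elim_inl, Sum.elim_inr]
      linarith
  refine ⟨transfer V (δ ⊗ₖ (1 : Matrix L L (FreeAlgebra ℂ (Fin d)))),
    memBallHinf_transfer hV fun m x hx v hv => nsq_evalM_kronecker_one_lt hx hv, ?_⟩
  refine transfer_eq_of_colligation hV (fun v hv => nsq_evalM_kronecker_one_lt hΛ hv)
    (H := fun k c => a k.1.2 (k.1.1, finProdFinEquiv (k.2, c))) fun i c => ?_
  have hcol := congrArg (fun M : Matrix _ _ ℂ => fun s => M s (finProdFinEquiv (i, c))) hVF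
  have hstate : ∀ k : Fin J × L, (Δ *ᵥ a k.2) (k.1, finProdFinEquiv (i, c)) =
      (evalM (δ ⊗ₖ (1 : Matrix L L (FreeAlgebra ℂ (Fin d)))) Λ *ᵥ
        fun k' => a k'.1.2 (k'.1.1, finProdFinEquiv (k'.2, c))) (k, i) := fun ⟨j, l⟩ => by
    have h := congrFun (congrArg (· *ᵥ a l) (evalM_intertwine (mul_colProj Λ c) δ)) (j, i)
    simp only [← mulVec_mulVec] at h
    rw [evalM_kronecker_one_mulVec, ← colProj_mulVec c fun t => (Δ *ᵥ a l) (j, t)]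
    rw [amp_mulVec] at h
    refine h.symm.trans (congrFun (congrArg (evalMat δ Λ *ᵥ ·) (funext fun b => ?_)) (j, i))
    exact (amp_mulVec _ _ _ _).trans (colProj_mulVec _ _ _)
  convert hcol using 1
  · change _ = V *ᵥ _
    congr 1
    ext (s | k)
    · exact (hflat_apply 1 i c).symm
    · exact (hstate k).symm
  · ext (s | k)
    · exact (hflat_apply _ i c).symm
    · rfl

end Realization

end PickInterpolation

/-- **Pick interpolation theorem** (Theorem 1.3).  Let `δ` be a `J × J` matrix of free
polynomials, `Λ ∈ G_δ ∩ M_n^d` and `W ∈ M_n(ℂ)`.  There is a function `φ` in the closed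
unit ball of `H^∞(G_δ)` with `φ(Λ) = W` iff there is a free polynomial `p₀` with
`p₀(Λ) = W` and `sup {‖p₀(x)‖ : x ∈ V_Λ ∩ G_δ} ≤ 1`. -/
theorem pick_interpolation {d J n : ℕ} (hd : 0 < d) (hn : 0 < n)
    (δ : Matrix (Fin J) (Fin J) (FreeAlgebra ℂ (Fin d)))
    (Λ : MatTuple d n) (hΛ : Λ ∈ Gdel δ n)
    (W : Matrix (Fin n) (Fin n) ℂ) :
    (∃ φ : ∀ m, MatTuple d m → Matrix (Fin m) (Fin m) ℂ,
        MemBallHinf (Gdel δ) φ ∧ φ n Λ = W) ↔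
      ∃ p₀ : FreeAlgebra ℂ (Fin d), evalPoly p₀ Λ = W ∧
        ∀ m, ∀ x ∈ VLam Λ m ∩ Gdel δ m, opNorm (evalPoly p₀ x) ≤ 1 := by
  constructor
  · rintro ⟨φ, hφ, rfl⟩
    exact exists_evalPoly_of_memBallHinf hφ hΛ
  · rintro ⟨p₀, rfl, hp₀⟩
    exact exists_memBallHinf_of_evalPoly hn hΛ hp₀
end

section
/- Let S be a set, let a, b ≥ 1, let F : S × S → M_a(ℂ) be an arbitrary function, and let 𝒱 be a finite-dimensional subspace, of dimension N, of the complex vector space of functions from S to the a×b complex matrices. If G : S × S → M_b(ℂ) can be represented in the form G(y,x) = Σ_{i=1}^m g_i(y)* F(y,x) g_i(x) for all (x,y) ∈ S × S, where m ∈ ℕ and g₁, …, g_m ∈ 𝒱 (and * denotes conjugate transpose), then G can be represented in the form G(y,x) = Σ_{i=1}^N f_i(y)* F(y,x) f_i(x) for all (x,y) ∈ S × S, with f₁, …, f_N ∈ 𝒱. -/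
open Matrix

open scoped ComplexOrder MatrixOrder in
/-- A Gram matrix `Cᴴ * C` has a square factor `A`, with the same Gram matrix. -/
theorem Matrix.exists_square_conjTranspose_mul_self_eq {ι κ : Type*} [Fintype ι] [Fintype κ]
    [DecidableEq κ] (C : Matrix ι κ ℂ) : ∃ A : Matrix κ κ ℂ, Aᴴ * A = Cᴴ * C := by
  obtain ⟨A, hA⟩ :=
    CStarAlgebra.nonneg_iff_eq_star_mul_self.mp (posSemidef_conjTranspose_mul_self C).nonneg
  exact ⟨A, hA.symm⟩

/-- A Hermitian sum of products of linear combinations depends on the coefficient matrix `C`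
only through its Gram matrix `Cᴴ * C`. -/
theorem Matrix.sum_conjTranspose_sum_smul_mul_mul {ι κ p q : Type*} [Fintype ι] [Fintype κ]
    [Fintype p] (C : Matrix ι κ ℂ) (M : Matrix p p ℂ) (u v : κ → Matrix p q ℂ) :
    ∑ i, (∑ j, C i j • u j)ᴴ * M * (∑ k, C i k • v k) =
      ∑ j, ∑ k, (Cᴴ * C) j k • ((u j)ᴴ * M * v k) := by
  simp only [conjTranspose_sum, conjTranspose_smul, Matrix.sum_mul, Matrix.mul_sum,
    Matrix.smul_mul, Matrix.mul_smul, smul_smul, Matrix.mul_apply, conjTranspose_apply,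
    Finset.sum_smul, Finset.smul_sum]
  calc _ = ∑ i, ∑ j, ∑ k, (star (C i j) * C i k) • ((u j)ᴴ * M * v k) := by
        refine Finset.sum_congr rfl fun i _ => ?_
        rw [Finset.sum_comm]
        simp only [mul_comm]
    _ = _ := by
        rw [Finset.sum_comm]
        exact Finset.sum_congr rfl fun j _ => Finset.sum_comm

/-- **Lemma 3.3 (term reduction).**  Let `S` be a set, `F : S × S → M_a(ℂ)` arbitrary, and
let `𝒱` be an `N`-dimensional subspace of the space of functions from `S` to the `a × b`
complex matrices.  If `G(y,x) = ∑_{i=1}^m g i (y)* F(y,x) g i (x)` with all `g i ∈ 𝒱`,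
then `G` admits such a representation with exactly `N` terms from `𝒱`. -/
theorem term_reduction {S : Type*} {a b : ℕ} (ha : 0 < a) (hb : 0 < b)
    (F : S → S → Matrix (Fin a) (Fin a) ℂ)
    (𝒱 : Submodule ℂ (S → Matrix (Fin a) (Fin b) ℂ))
    [FiniteDimensional ℂ 𝒱] (N : ℕ) (hdim : Module.finrank ℂ 𝒱 = N)
    (G : S → S → Matrix (Fin b) (Fin b) ℂ)
    (m : ℕ) (g : Fin m → S → Matrix (Fin a) (Fin b) ℂ) (hg : ∀ i, g i ∈ 𝒱)
    (hrep : ∀ x y : S, G y x = ∑ i : Fin m, (g i y)ᴴ * F y x * g i x) :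
    ∃ f : Fin N → S → Matrix (Fin a) (Fin b) ℂ, (∀ i, f i ∈ 𝒱) ∧
      ∀ x y : S, G y x = ∑ i : Fin N, (f i y)ᴴ * F y x * f i x := by
  let v := Module.finBasisOfFinrankEq ℂ 𝒱 hdim
  let C : Matrix (Fin m) (Fin N) ℂ := fun i j => v.repr ⟨g i, hg i⟩ j
  have hgC (i : Fin m) (x : S) : g i x = ∑ j, C i j • (v j : S → Matrix (Fin a) (Fin b) ℂ) x := by
    have h : (∑ j, C i j • v j : 𝒱) = ⟨g i, hg i⟩ := v.sum_repr _
    simpa [-Module.Basis.sum_repr] using congrFun (congrArg Subtype.val h.symm) x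
  obtain ⟨A, hA⟩ := C.exists_square_conjTranspose_mul_self_eq
  refine ⟨fun i => ∑ j, A i j • (v j : S → Matrix (Fin a) (Fin b) ℂ),
    fun i => 𝒱.sum_mem fun j _ => 𝒱.smul_mem _ (v j).2, fun x y => ?_⟩
  simp only [hrep, hgC, Finset.sum_apply, Pi.smul_apply]
  rw [sum_conjTranspose_sum_smul_mul_mul, sum_conjTranspose_sum_smul_mul_mul, hA]
end
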